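/- Let ψ : ℝ^d → ℝ satisfy the approximate-Dirac assumptions of order k with support radius r0, and let δ_ε(x) := ε^{-d} ψ(x/ε). Let s, m be integers with 0 ≤ s ≤ m and 1 ≤ m − s ≤ k + 1. Then there is a constant C depending only on ψ, d, s, m such that for every ε > 0, every smooth compactly supported v : ℝ^d → ℝ, and every multi-index α with |α| = s, ‖D^α(v − δ_ε ⋆ v)‖_{L²(ℝ^d)} ≤ C ε^{m − s} Σ_{|γ| = m − s} ‖D^{γ + α} v‖_{L²(ℝ^d)}; in particular the H^s-seminorm of v − δ_ε ⋆ v is bounded by C ε^{m−s} times the sum of the L² norms of all derivatives of v of order m. -/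

import Mathlib

open MeasureTheory

/-- The scaled kernel `δ_ε(x) = ε^{-d} ψ(x/ε)`. -/
noncomputable def scaledKernel (d : ℕ) (ψ : EuclideanSpace ℝ (Fin d) → ℝ) (ε : ℝ)
    (x : EuclideanSpace ℝ (Fin d)) : ℝ :=
  (ε ^ d)⁻¹ * ψ (ε⁻¹ • x)

/-- Partial derivative in the `i`-th coordinate direction. -/
noncomputable def pderivI {d : ℕ} (i : Fin d) (f : EuclideanSpace ℝ (Fin d) → ℝ)
    (x : EuclideanSpace ℝ (Fin d)) : ℝ :=
  fderiv ℝ f x (EuclideanSpace.single i 1)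

/-- Iterated partial derivative `D^α` associated with the multi-index `α`. -/
noncomputable def Dmulti {d : ℕ} (α : Fin d → ℕ) (f : EuclideanSpace ℝ (Fin d) → ℝ) :
    EuclideanSpace ℝ (Fin d) → ℝ :=
  ((List.ofFn fun i : Fin d => fun g : EuclideanSpace ℝ (Fin d) → ℝ =>
      (pderivI i)^[α i] g).foldr (· ∘ ·) id) f

open Filter Set
open scoped ENNReal NNReal ContDiff Convolution

section IteratedPartials

variable {d : ℕ}

/-- Iterated partial derivative along a list of coordinate directions. -/
noncomputable def listPderiv (L : List (Fin d)) (f : EuclideanSpace ℝ (Fin d) → ℝ) :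
    EuclideanSpace ℝ (Fin d) → ℝ :=
  L.foldr pderivI f

/-- The list containing each direction `i` exactly `α i` times, in increasing order. -/
def multiIndexList (α : Fin d → ℕ) : List (Fin d) :=
  (List.ofFn fun i => List.replicate (α i) i).flatten

theorem listPderiv_append (L L' : List (Fin d)) (f : EuclideanSpace ℝ (Fin d) → ℝ) :
    listPderiv (L ++ L') f = listPderiv L (listPderiv L' f) := by
  simp [listPderiv]

theorem listPderiv_replicate (n : ℕ) (i : Fin d) (f : EuclideanSpace ℝ (Fin d) → ℝ) :
    listPderiv (List.replicate n i) f = (pderivI i)^[n] f := by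
  induction n with
  | zero => rfl
  | succ n ih =>
    rw [List.replicate_succ, Function.iterate_succ_apply', ← ih]
    rfl

theorem Dmulti_eq_listPderiv (α : Fin d → ℕ) (f : EuclideanSpace ℝ (Fin d) → ℝ) :
    Dmulti α f = listPderiv (multiIndexList α) f := by
  have key (l : List (Fin d)) :
      ((l.map fun i => fun g : EuclideanSpace ℝ (Fin d) → ℝ => (pderivI i)^[α i] g).foldr
        (· ∘ ·) id) f = listPderiv (l.map fun i => List.replicate (α i) i).flatten f := by
    induction l with
    | nil => rfl
    | cons i l ih =>
      simp only [List.map_cons, List.foldr_cons, Function.comp_apply, List.flatten_cons]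
      rw [ih, listPderiv_append, listPderiv_replicate]
  simpa only [Dmulti, multiIndexList, List.ofFn_eq_map] using key (List.finRange d)

theorem count_multiIndexList (α : Fin d → ℕ) (i : Fin d) :
    (multiIndexList α).count i = α i := by
  simp [multiIndexList, List.count_flatten, List.map_ofFn, Function.comp_def, List.sum_ofFn,
    List.count_replicate]

theorem ContDiff.pderivI {f : EuclideanSpace ℝ (Fin d) → ℝ} (hf : ContDiff ℝ ∞ f)
    (i : Fin d) : ContDiff ℝ ∞ (pderivI i f) :=
  (hf.fderiv_right (m := ∞) (by simp)).clm_apply contDiff_const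

theorem ContDiff.listPderiv {f : EuclideanSpace ℝ (Fin d) → ℝ} (hf : ContDiff ℝ ∞ f)
    (L : List (Fin d)) : ContDiff ℝ ∞ (listPderiv L f) := by
  induction L with
  | nil => exact hf
  | cons i L ih => exact ih.pderivI i

theorem HasCompactSupport.pderivI {f : EuclideanSpace ℝ (Fin d) → ℝ}
    (hf : HasCompactSupport f) (i : Fin d) : HasCompactSupport (pderivI i f) :=
  hf.fderiv_apply ℝ _

theorem HasCompactSupport.listPderiv {f : EuclideanSpace ℝ (Fin d) → ℝ}
    (hf : HasCompactSupport f) (L : List (Fin d)) : HasCompactSupport (listPderiv L f) := by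
  induction L with
  | nil => exact hf
  | cons i L ih => exact ih.pderivI i

theorem pderivI_comm {f : EuclideanSpace ℝ (Fin d) → ℝ} (hf : ContDiff ℝ ∞ f)
    (i j : Fin d) : pderivI i (pderivI j f) = pderivI j (pderivI i f) := by
  have hdiff (x : EuclideanSpace ℝ (Fin d)) : DifferentiableAt ℝ (fderiv ℝ f) x :=
    (hf.fderiv_right (m := ∞) (by simp)).differentiable (by simp) x
  have second (i j : Fin d) (x : EuclideanSpace ℝ (Fin d)) : pderivI i (pderivI j f) x =
      fderiv ℝ (fderiv ℝ f) x (EuclideanSpace.single i 1) (EuclideanSpace.single j 1) := by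
    have := (hdiff x).hasFDerivAt.clm_apply
      (hasFDerivAt_const (EuclideanSpace.single j (1 : ℝ)) x)
    change fderiv ℝ (fun y => fderiv ℝ f y (EuclideanSpace.single j 1)) x _ = _
    rw [this.fderiv]
    simp
  ext x
  rw [second, second]
  have htwo : minSmoothness ℝ 2 ≤ (∞ : ℕ∞ω) := by
    rw [minSmoothness_of_isRCLikeNormedField]
    exact WithTop.coe_le_coe.2 (le_top : (2 : ℕ∞) ≤ ⊤)
  exact (hf.contDiffAt.isSymmSndFDerivAt htwo).eq _ _

theorem List.Perm.listPderiv_eq {L L' : List (Fin d)} (h : L.Perm L')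
    {f : EuclideanSpace ℝ (Fin d) → ℝ} (hf : ContDiff ℝ ∞ f) :
    listPderiv L f = listPderiv L' f := by
  induction h with
  | nil => rfl
  | cons i _ ih => exact congrArg (pderivI i) ih
  | swap i j L => exact pderivI_comm (hf.listPderiv L) j i
  | trans _ _ ih₁ ih₂ => exact ih₁.trans ih₂

theorem listPderiv_Dmulti {f : EuclideanSpace ℝ (Fin d) → ℝ} (hf : ContDiff ℝ ∞ f)
    (L : List (Fin d)) (α : Fin d → ℕ) :
    listPderiv L (Dmulti α f) = Dmulti ((fun i => L.count i) + α) f := by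
  rw [Dmulti_eq_listPderiv, Dmulti_eq_listPderiv, ← listPderiv_append]
  refine List.Perm.listPderiv_eq (List.perm_iff_count.2 fun i => ?_) hf
  simp [count_multiIndexList]

theorem prod_map_eq_prod_pow_count (L : List (Fin d)) (z : Fin d → ℝ) :
    (L.map z).prod = ∏ i, z i ^ L.count i := by
  rw [Finset.prod_list_map_count]
  refine Finset.prod_subset (Finset.subset_univ _) fun i _ hi => ?_
  rw [List.count_eq_zero.2 (by simpa using hi), pow_zero]

theorem sum_count_eq_length (L : List (Fin d)) : ∑ i, L.count i = L.length := by
  induction L with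
  | nil => simp
  | cons a L ih => simp [List.count_cons, Finset.sum_add_distrib, ih]

end IteratedPartials

section Taylor

theorem abs_sub_taylor_le_integral {g : ℕ → ℝ → ℝ}
    (hg : ∀ j t, HasDerivAt (g j) (g (j + 1) t) t) (n : ℕ) {x : ℝ} (hx : x ∈ Icc (0 : ℝ) 1) :
    |g 0 x - ∑ j ∈ Finset.range (n + 1), g j 0 * (x ^ j / j.factorial)| ≤
      ∫ t in (0 : ℝ)..1, |g (n + 1) t| := by
  have hcont (j : ℕ) : Continuous (g j) :=
    continuous_iff_continuousAt.2 fun t => (hg j t).continuousAt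
  induction n generalizing g x with
  | zero =>
    have h1 : g 0 x - g 0 0 = ∫ t in (0 : ℝ)..x, g 1 t :=
      (intervalIntegral.integral_eq_sub_of_hasDerivAt (fun t _ => hg 0 t)
        ((hcont 1).intervalIntegrable _ _)).symm
    simp only [zero_add, Finset.range_one, Finset.sum_singleton, pow_zero, Nat.factorial_zero,
      Nat.cast_one, div_one, mul_one, h1]
    refine (intervalIntegral.abs_integral_le_integral_abs hx.1).trans ?_
    exact intervalIntegral.integral_mono_interval le_rfl hx.1 hx.2
      (Eventually.of_forall fun t => abs_nonneg _) ((hcont 1).abs.intervalIntegrable _ _)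
  | succ n ih =>
    set A := ∫ t in (0 : ℝ)..1, |g (n + 1 + 1) t|
    have hA : 0 ≤ A := intervalIntegral.integral_nonneg zero_le_one fun t _ => abs_nonneg _
    set h : ℝ → ℝ := fun t => g 0 t -
      ∑ j ∈ Finset.range (n + 1 + 1), g j 0 * (t ^ j / j.factorial) with hh
    have hderiv (t : ℝ) : HasDerivAt h
        (g 1 t - ∑ j ∈ Finset.range (n + 1), g (j + 1) 0 * (t ^ j / j.factorial)) t := by
      refine (hg 0 t).sub ?_
      have hsum : HasDerivAt
          (fun t : ℝ => ∑ j ∈ Finset.range (n + 1 + 1), g j 0 * (t ^ j / j.factorial))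
          (∑ j ∈ Finset.range (n + 1 + 1), g j 0 * (j * t ^ (j - 1) / j.factorial)) t :=
        HasDerivAt.fun_sum fun j _ => ((hasDerivAt_pow j t).div_const _).const_mul _
      refine hsum.congr_deriv ?_
      rw [Finset.sum_range_succ' _ (n + 1)]
      simp only [Nat.cast_zero, zero_mul, zero_div, mul_zero, add_zero, Nat.add_sub_cancel]
      refine Finset.sum_congr rfl fun j _ => ?_
      rw [Nat.factorial_succ]
      push_cast
      field_simp
    have hbound := (convex_Icc (0 : ℝ) 1).norm_image_sub_le_of_norm_hasDerivWithin_le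
      (f := h) (C := A) (fun t _ => (hderiv t).hasDerivWithinAt)
      (fun t ht => ih (g := fun j => g (j + 1)) (fun j t => hg (j + 1) t) ht
        fun j => hcont (j + 1)) (left_mem_Icc.2 zero_le_one) hx
    have h0 : h 0 = 0 := by
      simp [hh, Finset.sum_range_succ' _ (n + 1)]
    rw [h0, sub_zero, sub_zero, Real.norm_eq_abs, Real.norm_eq_abs, abs_of_nonneg hx.1] at hbound
    exact hbound.trans (mul_le_of_le_one_right hA hx.2)

variable {d : ℕ}

/-- The `j`-th derivative at time `t` of `t ↦ w (x + t • y)`, expanded in partial derivatives. -/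
noncomputable def lineDerivative (w : EuclideanSpace ℝ (Fin d) → ℝ)
    (x y : EuclideanSpace ℝ (Fin d)) (j : ℕ) (t : ℝ) : ℝ :=
  ∑ I : Fin j → Fin d,
    ((List.ofFn I).map fun i => y i).prod * listPderiv (List.ofFn I) w (x + t • y)

theorem hasDerivAt_comp_line {w : EuclideanSpace ℝ (Fin d) → ℝ} (hw : ContDiff ℝ ∞ w)
    (x y : EuclideanSpace ℝ (Fin d)) (t : ℝ) :
    HasDerivAt (fun t : ℝ => w (x + t • y)) (∑ i, y i * pderivI i w (x + t • y)) t := by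
  have hline : HasDerivAt (fun t : ℝ => x + t • y) y t := by
    simpa using ((hasDerivAt_id t).smul_const y).const_add x
  have := ((hw.differentiable (by simp)) (x + t • y)).hasFDerivAt.comp_hasDerivAt t hline
  refine this.congr_deriv ?_
  have hy : y = ∑ i, y i • EuclideanSpace.single i (1 : ℝ) := by
    simpa using ((EuclideanSpace.basisFun (Fin d) ℝ).sum_repr y).symm
  conv_lhs => arg 2; rw [hy]
  rw [map_sum]
  simp only [map_smul, smul_eq_mul]
  rfl

theorem hasDerivAt_lineDerivative {w : EuclideanSpace ℝ (Fin d) → ℝ} (hw : ContDiff ℝ ∞ w)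
    (x y : EuclideanSpace ℝ (Fin d)) (j : ℕ) (t : ℝ) :
    HasDerivAt (lineDerivative w x y j) (lineDerivative w x y (j + 1) t) t := by
  have hsum := HasDerivAt.fun_sum (u := Finset.univ) fun (I : Fin j → Fin d) _ =>
    (hasDerivAt_comp_line (hw.listPderiv (List.ofFn I)) x y t).const_mul
      ((List.ofFn I).map fun i => y i).prod
  refine hsum.congr_deriv ?_
  rw [lineDerivative, ← (Fin.consEquiv fun _ => Fin d).sum_comp, Fintype.sum_prod_type_right]
  refine Finset.sum_congr rfl fun I _ => ?_
  rw [Finset.mul_sum]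
  refine Finset.sum_congr rfl fun i _ => ?_
  simp [Fin.consEquiv, List.ofFn_succ, listPderiv]
  ring

theorem lineDerivative_zero (w : EuclideanSpace ℝ (Fin d) → ℝ)
    (x y : EuclideanSpace ℝ (Fin d)) (t : ℝ) : lineDerivative w x y 0 t = w (x + t • y) := by
  simp [lineDerivative, listPderiv]

end Taylor

section Minkowski

theorem sq_lintegral_le_measure_univ_mul {P : Type*} [MeasurableSpace P] (ν : Measure P)
    {f : P → ℝ≥0∞} (hf : AEMeasurable f ν) :
    (∫⁻ p, f p ∂ν) ^ 2 ≤ ν univ * ∫⁻ p, f p ^ 2 ∂ν := by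
  have h := ENNReal.lintegral_mul_le_Lp_mul_Lq ν Real.HolderConjugate.two_two hf
    (aemeasurable_const (b := (1 : ℝ≥0∞)))
  simp only [Pi.mul_apply, mul_one, ENNReal.rpow_two, one_pow, lintegral_const, one_mul] at h
  calc (∫⁻ p, f p ∂ν) ^ 2
      ≤ ((∫⁻ p, f p ^ 2 ∂ν) ^ (1 / (2 : ℝ)) * ν univ ^ (1 / (2 : ℝ))) ^ 2 := by gcongr
    _ = ν univ * ∫⁻ p, f p ^ 2 ∂ν := by
      rw [mul_pow, ← ENNReal.rpow_two, ← ENNReal.rpow_two, ← ENNReal.rpow_mul,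
        ← ENNReal.rpow_mul]
      norm_num [mul_comm]

theorem eLpNorm_two_lintegral_translate_le {G P : Type*} [AddGroup G] [MeasurableSpace G]
    [MeasurableAdd₂ G] (μ : Measure G) [SFinite μ] [μ.IsAddRightInvariant]
    [MeasurableSpace P] (ν : Measure P) [SFinite ν] {u : G → ℝ} (hu : Measurable u)
    {φ : P → G} (hφ : Measurable φ) :
    eLpNorm (fun x => ∫⁻ p, ‖u (x + φ p)‖ₑ ∂ν) 2 μ ≤ ν univ * eLpNorm u 2 μ := by
  have hsq : ∫⁻ x, (∫⁻ p, ‖u (x + φ p)‖ₑ ∂ν) ^ 2 ∂μ ≤ ν univ ^ 2 * ∫⁻ x, ‖u x‖ₑ ^ 2 ∂μ := by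
    calc ∫⁻ x, (∫⁻ p, ‖u (x + φ p)‖ₑ ∂ν) ^ 2 ∂μ
        ≤ ∫⁻ x, ν univ * ∫⁻ p, ‖u (x + φ p)‖ₑ ^ 2 ∂ν ∂μ := by
          refine lintegral_mono fun x => sq_lintegral_le_measure_univ_mul ν ?_
          fun_prop
      _ = ν univ * ∫⁻ p, ∫⁻ x, ‖u (x + φ p)‖ₑ ^ 2 ∂μ ∂ν := by
          rw [lintegral_const_mul, lintegral_lintegral_swap]
          · fun_prop
          · fun_prop
      _ = ν univ ^ 2 * ∫⁻ x, ‖u x‖ₑ ^ 2 ∂μ := by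
          simp_rw [fun p => lintegral_add_right_eq_self (μ := μ) (fun x => ‖u x‖ₑ ^ 2) (φ p)]
          rw [lintegral_const, sq, mul_assoc, mul_comm (ν univ) (∫⁻ x, ‖u x‖ₑ ^ 2 ∂μ)]
  rw [eLpNorm_eq_lintegral_rpow_enorm_toReal (by simp) (by simp),
    eLpNorm_eq_lintegral_rpow_enorm_toReal (by simp) (by simp)]
  simp only [ENNReal.toReal_ofNat, ENNReal.rpow_two, enorm_eq_self]
  refine (ENNReal.rpow_le_rpow hsq (by norm_num)).trans ?_
  rw [ENNReal.mul_rpow_of_nonneg _ _ (by norm_num), ← ENNReal.rpow_two, ← ENNReal.rpow_mul]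
  norm_num

end Minkowski

section Kernel

variable {d : ℕ} {ψ : EuclideanSpace ℝ (Fin d) → ℝ} {r : ℝ}

theorem integrable_of_essBounded_of_support_subset (hmeas : Measurable ψ)
    (hbd : eLpNorm ψ ⊤ volume ≠ ⊤)
    (hsupp : ∀ x : EuclideanSpace ℝ (Fin d), x ∉ Metric.closedBall 0 r → ψ x = 0) :
    Integrable ψ := by
  have hLp : MemLp ψ ⊤ volume := ⟨hmeas.aestronglyMeasurable, hbd.lt_top⟩
  have hon : IntegrableOn ψ (Metric.closedBall 0 r) := by
    have : IsFiniteMeasure (volume.restrict (Metric.closedBall (0 : EuclideanSpace ℝ (Fin d)) r)) :=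
      ⟨by simpa using measure_closedBall_lt_top⟩
    exact (hLp.restrict _).integrable le_top
  refine (integrableOn_iff_integrable_of_support_subset fun x hx => ?_).1 hon
  by_contra h
  exact hx (hsupp x h)

theorem Integrable.mul_continuous_of_support_subset (hψ : Integrable ψ)
    (hsupp : ∀ x : EuclideanSpace ℝ (Fin d), x ∉ Metric.closedBall 0 r → ψ x = 0)
    {f : EuclideanSpace ℝ (Fin d) → ℝ} (hf : Continuous f) :
    Integrable fun z => ψ z * f z := by
  refine (integrableOn_iff_integrable_of_support_subset (s := Metric.closedBall 0 r)
    fun x hx => ?_).1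
    (hψ.integrableOn.mul_continuousOn hf.continuousOn (isCompact_closedBall _ _))
  by_contra h
  exact hx (by simp [hsupp x h])

theorem integrable_scaledKernel (hψ : Integrable ψ) {ε : ℝ} (hε : 0 < ε) :
    Integrable (scaledKernel d ψ ε) :=
  (hψ.comp_smul (inv_ne_zero hε.ne')).const_mul _

/-- The regularization error `v - δ_ε ⋆ v`. -/
noncomputable def regularizationError (ψ : EuclideanSpace ℝ (Fin d) → ℝ) (ε : ℝ)
    (v : EuclideanSpace ℝ (Fin d) → ℝ) (x : EuclideanSpace ℝ (Fin d)) : ℝ :=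
  v x - ∫ y : EuclideanSpace ℝ (Fin d), scaledKernel d ψ ε (x - y) * v y

theorem pderivI_regularizationError (hψ : Integrable ψ) {ε : ℝ} (hε : 0 < ε)
    {v : EuclideanSpace ℝ (Fin d) → ℝ} (hv : ContDiff ℝ ∞ v) (hvs : HasCompactSupport v)
    (i : Fin d) :
    pderivI i (regularizationError ψ ε v) = regularizationError ψ ε (pderivI i v) := by
  have hK := (integrable_scaledKernel hψ hε).locallyIntegrable
  have hconv (u : EuclideanSpace ℝ (Fin d) → ℝ) (x : EuclideanSpace ℝ (Fin d)) :
      (∫ y, scaledKernel d ψ ε (x - y) * u y) =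
        (scaledKernel d ψ ε ⋆[ContinuousLinearMap.lsmul ℝ ℝ, volume] u) x := by
    simp [convolution_eq_swap]
  have hv1 : ContDiff ℝ 1 v := hv.of_le (by simp)
  ext x
  have hder := ((hv1.differentiable one_ne_zero) x).hasFDerivAt.sub
    (hvs.hasFDerivAt_convolution_right (ContinuousLinearMap.lsmul ℝ ℝ) hK hv1 x)
  have heq : regularizationError ψ ε v =
      v - (scaledKernel d ψ ε ⋆[ContinuousLinearMap.lsmul ℝ ℝ, volume] v) := by
    ext x
    simp [regularizationError, hconv]
  rw [pderivI, heq, hder.fderiv, sub_apply,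
    convolution_precompR_apply _ hK (hvs.fderiv ℝ) (hv1.continuous_fderiv one_ne_zero),
    regularizationError, hconv]
  rfl

theorem listPderiv_regularizationError (hψ : Integrable ψ) {ε : ℝ} (hε : 0 < ε)
    {v : EuclideanSpace ℝ (Fin d) → ℝ} (hv : ContDiff ℝ ∞ v) (hvs : HasCompactSupport v)
    (L : List (Fin d)) :
    listPderiv L (regularizationError ψ ε v) = regularizationError ψ ε (listPderiv L v) := by
  induction L with
  | nil => rfl
  | cons i L ih =>
    exact (congrArg (pderivI i) ih).trans
      (pderivI_regularizationError hψ hε (hv.listPderiv L) (hvs.listPderiv L) i)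

theorem integral_scaledKernel_mul (ψ w : EuclideanSpace ℝ (Fin d) → ℝ) {ε : ℝ} (hε : 0 < ε)
    (x : EuclideanSpace ℝ (Fin d)) :
    (∫ y, scaledKernel d ψ ε (x - y) * w y) = ∫ z, ψ z * w (x + (-ε) • z) := by
  have hεd : ε ^ d ≠ 0 := pow_ne_zero _ hε.ne'
  have h1 := integral_sub_left_eq_self
    (fun t => scaledKernel d ψ ε t * w (x - t)) (volume : Measure (EuclideanSpace ℝ (Fin d))) x
  have h2 := Measure.integral_comp_smul (volume : Measure (EuclideanSpace ℝ (Fin d)))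
    (fun t => scaledKernel d ψ ε t * w (x - t)) ε
  simp only [sub_sub_cancel] at h1
  rw [finrank_euclideanSpace_fin, abs_of_pos (by positivity), smul_eq_mul] at h2
  rw [h1, ← mul_right_inj' (inv_ne_zero hεd), ← h2, ← integral_const_mul]
  congr 1 with z
  simp only [scaledKernel, smul_smul, inv_mul_cancel₀ hε.ne', one_smul, neg_smul, sub_eq_add_neg]
  ring

theorem integral_mul_lineDerivative_eq_zero {k : ℕ}
    (hψ : Integrable ψ)
    (hsupp : ∀ x : EuclideanSpace ℝ (Fin d), x ∉ Metric.closedBall 0 r → ψ x = 0)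
    (hmom : ∀ β : Fin d → ℕ, 1 ≤ ∑ i, β i → ∑ i, β i ≤ k →
      (∫ y : EuclideanSpace ℝ (Fin d), (∏ i, y i ^ β i) * ψ y) = 0)
    (w : EuclideanSpace ℝ (Fin d) → ℝ) (x : EuclideanSpace ℝ (Fin d)) (c : ℝ) {j : ℕ}
    (hj : 1 ≤ j) (hjk : j ≤ k) :
    (∫ z, ψ z * lineDerivative w x (c • z) j 0) = 0 := by
  have hterm (L : List (Fin d)) (z : EuclideanSpace ℝ (Fin d)) :
      (L.map fun i => (c • z) i).prod = c ^ L.length * ∏ i, z i ^ L.count i := by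
    rw [prod_map_eq_prod_pow_count L (fun i => (c • z) i)]
    simp [mul_pow, Finset.prod_mul_distrib, Finset.prod_pow_eq_pow_sum, sum_count_eq_length]
  have hexp (z : EuclideanSpace ℝ (Fin d)) : ψ z * lineDerivative w x (c • z) j 0 =
      ∑ I : Fin j → Fin d, ψ z * (∏ i, z i ^ (List.ofFn I).count i) *
        (c ^ j * listPderiv (List.ofFn I) w x) := by
    rw [lineDerivative, Finset.mul_sum]
    refine Finset.sum_congr rfl fun I _ => ?_
    rw [hterm, List.length_ofFn, zero_smul, add_zero]
    ring
  simp_rw [hexp]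
  rw [integral_finsetSum]
  · refine Finset.sum_eq_zero fun I _ => ?_
    have hI := hmom (fun i => (List.ofFn I).count i)
      (by rwa [sum_count_eq_length, List.length_ofFn])
      (by rwa [sum_count_eq_length, List.length_ofFn])
    rw [integral_mul_const]
    simp_rw [mul_comm (ψ _)]
    rw [hI, zero_mul]
  · intro I _
    refine Integrable.mul_const ?_ _
    exact Integrable.mul_continuous_of_support_subset hψ hsupp (by fun_prop)

theorem regularizationError_eq_integral_taylor_remainder {k n : ℕ} (hnk : n ≤ k)
    (hψ : Integrable ψ)
    (hsupp : ∀ x : EuclideanSpace ℝ (Fin d), x ∉ Metric.closedBall 0 r → ψ x = 0)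
    (hunit : (∫ y : EuclideanSpace ℝ (Fin d), ψ y) = 1)
    (hmom : ∀ β : Fin d → ℕ, 1 ≤ ∑ i, β i → ∑ i, β i ≤ k →
      (∫ y : EuclideanSpace ℝ (Fin d), (∏ i, y i ^ β i) * ψ y) = 0)
    {ε : ℝ} (hε : 0 < ε) {w : EuclideanSpace ℝ (Fin d) → ℝ} (hw : ContDiff ℝ ∞ w)
    (x : EuclideanSpace ℝ (Fin d)) :
    regularizationError ψ ε w x =
      -∫ z, ψ z * (lineDerivative w x ((-ε) • z) 0 1 -
        ∑ j ∈ Finset.range (n + 1),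
          lineDerivative w x ((-ε) • z) j 0 * (1 ^ j / j.factorial)) := by
  have hcont := hw.continuous
  have hprod (L : List (Fin d)) :
      Continuous fun z : EuclideanSpace ℝ (Fin d) => (L.map fun i => ((-ε) • z) i).prod :=
    continuous_list_prod _ fun i _ => by fun_prop
  have hint (j : ℕ) :
      Integrable fun z => ψ z * lineDerivative w x ((-ε) • z) j 0 := by
    refine Integrable.mul_continuous_of_support_subset hψ hsupp ?_
    simp only [lineDerivative, zero_smul, add_zero]
    exact continuous_finsetSum _ fun I _ => (hprod _).mul continuous_const
  have hint0 : Integrable fun z => ψ z * w (x + (-ε) • z) :=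
    Integrable.mul_continuous_of_support_subset hψ hsupp (by fun_prop)
  have hexp (z : EuclideanSpace ℝ (Fin d)) :
      ψ z * (lineDerivative w x ((-ε) • z) 0 1 - ∑ j ∈ Finset.range (n + 1),
        lineDerivative w x ((-ε) • z) j 0 * (1 ^ j / j.factorial)) =
      ψ z * w (x + (-ε) • z) - ∑ j ∈ Finset.range (n + 1),
        ψ z * lineDerivative w x ((-ε) • z) j 0 * (1 ^ j / j.factorial) := by
    rw [mul_sub, lineDerivative_zero, one_smul, Finset.mul_sum]
    simp only [mul_assoc]
  simp_rw [hexp]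
  rw [integral_sub hint0 (integrable_finsetSum _ fun j _ => (hint j).mul_const _),
    integral_finsetSum _ fun j _ => (hint j).mul_const _, Finset.sum_range_succ',
    Finset.sum_eq_zero]
  · simp only [lineDerivative_zero, zero_smul, add_zero, integral_mul_const, hunit,
      regularizationError, integral_scaledKernel_mul ψ w hε]
    simp
  · intro j hj
    rw [integral_mul_const, integral_mul_lineDerivative_eq_zero hψ hsupp hmom w x (-ε)
      (Nat.le_add_left 1 j) ((Nat.succ_le_of_lt (Finset.mem_range.1 hj)).trans hnk), zero_mul]

theorem enorm_taylor_remainder_le {w : EuclideanSpace ℝ (Fin d) → ℝ} (hw : ContDiff ℝ ∞ w)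
    (x y : EuclideanSpace ℝ (Fin d)) {R : ℝ≥0} (hy : ‖y‖₊ ≤ R) (n : ℕ) :
    ‖lineDerivative w x y 0 1 - ∑ j ∈ Finset.range (n + 1),
        lineDerivative w x y j 0 * (1 ^ j / j.factorial)‖ₑ ≤
      R ^ (n + 1) * ∑ I : Fin (n + 1) → Fin d,
        ∫⁻ t in Ioc (0 : ℝ) 1, ‖listPderiv (List.ofFn I) w (x + t • y)‖ₑ := by
  have hg := hasDerivAt_lineDerivative hw x y
  have hcont : Continuous (lineDerivative w x y (n + 1)) :=
    continuous_iff_continuousAt.2 fun t => (hg (n + 1) t).continuousAt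
  have hT := abs_sub_taylor_le_integral hg n (right_mem_Icc.2 zero_le_one)
  have hprod (L : List (Fin d)) : ‖(L.map fun i => y i).prod‖ₑ ≤ R ^ L.length := by
    induction L with
    | nil => simp
    | cons i L ih =>
      rw [List.map_cons, List.prod_cons, enorm_mul, List.length_cons, pow_succ']
      gcongr
      rw [← ofReal_norm, ← ENNReal.ofReal_coe_nnreal]
      exact ENNReal.ofReal_le_ofReal ((PiLp.norm_apply_le y i).trans hy)
  rw [Real.enorm_eq_ofReal_abs]
  refine (ENNReal.ofReal_le_ofReal hT).trans ?_
  rw [intervalIntegral.integral_of_le zero_le_one,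
    ofReal_integral_eq_lintegral_ofReal (hcont.abs.integrableOn_Ioc)
      (Eventually.of_forall fun t => abs_nonneg _), ← lintegral_finsetSum', ← lintegral_const_mul']
  · refine lintegral_mono fun t => ?_
    rw [← Real.enorm_eq_ofReal_abs, lineDerivative, Finset.mul_sum]
    refine (enorm_sum_le _ _).trans (Finset.sum_le_sum fun I _ => ?_)
    rw [enorm_mul]
    gcongr
    simpa using hprod (List.ofFn I)
  · exact ENNReal.pow_ne_top ENNReal.coe_ne_top
  · intro I _
    have := (hw.listPderiv (List.ofFn I)).continuous
    exact Continuous.aemeasurable (by fun_prop)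

theorem enorm_regularizationError_le {k n : ℕ} (hnk : n ≤ k) (hr : 0 < r)
    (hmeas : Measurable ψ) (hbd : eLpNorm ψ ⊤ volume ≠ ⊤)
    (hsupp : ∀ x : EuclideanSpace ℝ (Fin d), x ∉ Metric.closedBall 0 r → ψ x = 0)
    (hunit : (∫ y : EuclideanSpace ℝ (Fin d), ψ y) = 1)
    (hmom : ∀ β : Fin d → ℕ, 1 ≤ ∑ i, β i → ∑ i, β i ≤ k →
      (∫ y : EuclideanSpace ℝ (Fin d), (∏ i, y i ^ β i) * ψ y) = 0)
    {ε : ℝ} (hε : 0 < ε) {w : EuclideanSpace ℝ (Fin d) → ℝ} (hw : ContDiff ℝ ∞ w)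
    (x : EuclideanSpace ℝ (Fin d)) :
    ‖regularizationError ψ ε w x‖ₑ ≤
      ↑((eLpNorm ψ ⊤ volume).toNNReal * (ε * r).toNNReal ^ (n + 1)) *
        ∑ I : Fin (n + 1) → Fin d,
          ∫⁻ p, ‖listPderiv (List.ofFn I) w (x + p.2 • (-ε) • p.1)‖ₑ
            ∂((volume.restrict (Metric.closedBall (0 : EuclideanSpace ℝ (Fin d)) r)).prod
              (volume.restrict (Ioc (0 : ℝ) 1))) := by
  set M := eLpNorm ψ ⊤ volume with hM
  have hψ := integrable_of_essBounded_of_support_subset hmeas hbd hsupp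
  have hcont (I : Fin (n + 1) → Fin d) := (hw.listPderiv (List.ofFn I)).continuous
  have hmeasI (I : Fin (n + 1) → Fin d) :
      Measurable fun p : EuclideanSpace ℝ (Fin d) × ℝ =>
        ‖listPderiv (List.ofFn I) w (x + p.2 • (-ε) • p.1)‖ₑ := by
    have := hcont I
    exact Continuous.measurable (by fun_prop)
  rw [regularizationError_eq_integral_taylor_remainder hnk hψ hsupp hunit hmom hε hw x,
    enorm_neg]
  refine (enorm_integral_le_lintegral_enorm _).trans ?_
  rw [Finset.sum_congr rfl fun I _ => lintegral_prod _ (hmeasI I).aemeasurable]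
  rw [← lintegral_finsetSum _ fun I _ => (hmeasI I).lintegral_prod_right',
    ← lintegral_const_mul' _ _ ENNReal.coe_ne_top,
    ← lintegral_indicator Metric.isClosed_closedBall.measurableSet]
  refine lintegral_mono_ae ?_
  filter_upwards [ae_le_eLpNormEssSup (f := ψ) (μ := volume)] with z hz
  rw [← eLpNorm_exponent_top, ← hM] at hz
  by_cases hzr : z ∈ Metric.closedBall (0 : EuclideanSpace ℝ (Fin d)) r
  · rw [indicator_of_mem hzr, enorm_mul, ENNReal.coe_mul, ENNReal.coe_toNNReal hbd,
      ENNReal.coe_pow, mul_assoc]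
    refine mul_le_mul' hz (enorm_taylor_remainder_le hw x _ ?_ n)
    rw [mem_closedBall_zero_iff] at hzr
    rw [← NNReal.coe_le_coe, coe_nnnorm, Real.coe_toNNReal _ (by positivity), norm_smul, norm_neg,
      Real.norm_of_nonneg hε.le]
    gcongr
  · simp [hsupp z hzr]

theorem eLpNorm_regularizationError_le {k n : ℕ} (hnk : n ≤ k) (hr : 0 < r)
    (hmeas : Measurable ψ) (hbd : eLpNorm ψ ⊤ volume ≠ ⊤)
    (hsupp : ∀ x : EuclideanSpace ℝ (Fin d), x ∉ Metric.closedBall 0 r → ψ x = 0)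
    (hunit : (∫ y : EuclideanSpace ℝ (Fin d), ψ y) = 1)
    (hmom : ∀ β : Fin d → ℕ, 1 ≤ ∑ i, β i → ∑ i, β i ≤ k →
      (∫ y : EuclideanSpace ℝ (Fin d), (∏ i, y i ^ β i) * ψ y) = 0)
    {ε : ℝ} (hε : 0 < ε) {w : EuclideanSpace ℝ (Fin d) → ℝ} (hw : ContDiff ℝ ∞ w) :
    eLpNorm (regularizationError ψ ε w) 2 volume ≤
      ↑((eLpNorm ψ ⊤ volume).toNNReal * (ε * r).toNNReal ^ (n + 1)) *
        ∑ I : Fin (n + 1) → Fin d,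
          volume (Metric.closedBall (0 : EuclideanSpace ℝ (Fin d)) r) *
            eLpNorm (listPderiv (List.ofFn I) w) 2 volume := by
  set ν := (volume.restrict (Metric.closedBall (0 : EuclideanSpace ℝ (Fin d)) r)).prod
    (volume.restrict (Ioc (0 : ℝ) 1)) with hν
  have hνu : ν univ = volume (Metric.closedBall (0 : EuclideanSpace ℝ (Fin d)) r) := by
    rw [hν, ← univ_prod_univ, Measure.prod_prod]
    simp
  have hcont (I : Fin (n + 1) → Fin d) := (hw.listPderiv (List.ofFn I)).continuous
  set A : (Fin (n + 1) → Fin d) → EuclideanSpace ℝ (Fin d) → ℝ≥0∞ := fun I x =>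
    ∫⁻ p, ‖listPderiv (List.ofFn I) w (x + p.2 • (-ε) • p.1)‖ₑ ∂ν with hA
  have hAmeas (I : Fin (n + 1) → Fin d) : Measurable (A I) := by
    have := hcont I
    refine Measurable.lintegral_prod_right' (ν := ν)
      (f := fun q : EuclideanSpace ℝ (Fin d) × (EuclideanSpace ℝ (Fin d) × ℝ) =>
        ‖listPderiv (List.ofFn I) w (q.1 + q.2.2 • (-ε) • q.2.1)‖ₑ) ?_
    exact Continuous.measurable (by fun_prop)
  calc eLpNorm (regularizationError ψ ε w) 2 volume
      ≤ ↑((eLpNorm ψ ⊤ volume).toNNReal * (ε * r).toNNReal ^ (n + 1)) *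
          eLpNorm (∑ I, A I) 2 volume := by
        refine eLpNorm_le_nnreal_smul_eLpNorm_of_ae_le_mul' (Eventually.of_forall fun x => ?_) 2
        rw [enorm_eq_self, Finset.sum_apply]
        exact enorm_regularizationError_le hnk hr hmeas hbd hsupp hunit hmom hε hw x
    _ ≤ _ := by
        gcongr
        refine (eLpNorm_sum_le (fun I _ => (hAmeas I).aestronglyMeasurable)
          one_le_two).trans (Finset.sum_le_sum fun I _ => ?_)
        rw [← hνu]
        exact eLpNorm_two_lintegral_translate_le volume ν (hcont I).measurable
          (φ := fun p => p.2 • (-ε) • p.1) (by fun_prop)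

end Kernel

/-- higher-order Sobolev seminorm estimates for the regularization error in `ℝ^d`:
`‖D^α(v − δ_ε ⋆ v)‖_{L²} ≤ C ε^{m−s} Σ_{|γ|=m−s} ‖D^{γ+α} v‖_{L²}` for `|α| = s`. -/
theorem regularization_Hs_error_Rd
    (d : ℕ) (hd : 1 ≤ d) (k : ℕ) (r0 : ℝ) (hr0 : 0 < r0)
    (ψ : EuclideanSpace ℝ (Fin d) → ℝ)
    (hmeas : Measurable ψ)
    (hbd : eLpNorm ψ ⊤ volume ≠ ⊤)
    (hsupp : ∀ x : EuclideanSpace ℝ (Fin d), x ∉ Metric.closedBall 0 r0 → ψ x = 0)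
    (hunit : (∫ y : EuclideanSpace ℝ (Fin d), ψ y) = 1)
    (hmom : ∀ β : Fin d → ℕ, 1 ≤ ∑ i, β i → ∑ i, β i ≤ k →
      (∫ y : EuclideanSpace ℝ (Fin d), (∏ i, y i ^ β i) * ψ y) = 0)
    (s m : ℕ) (hsm : s ≤ m) (hms1 : 1 ≤ m - s) (hmsk : m - s ≤ k + 1) :
    ∃ C : ℝ, 0 < C ∧ ∀ ε : ℝ, 0 < ε →
      ∀ v : EuclideanSpace ℝ (Fin d) → ℝ, ContDiff ℝ (⊤ : ℕ∞) v → HasCompactSupport v →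
        ∀ α : Fin d → ℕ, ∑ i, α i = s →
          eLpNorm
              (Dmulti α (fun x => v x -
                ∫ y : EuclideanSpace ℝ (Fin d), scaledKernel d ψ ε (x - y) * v y))
              2 volume ≤
            ENNReal.ofReal (C * ε ^ (m - s)) *
              ∑ γ ∈ Finset.Nat.antidiagonalTuple d (m - s),
                eLpNorm (Dmulti (γ + α) v) 2 volume := by
  obtain ⟨n, hn⟩ : ∃ n, m - s = n + 1 := ⟨m - s - 1, by omega⟩
  rw [hn] at hmsk ⊢
  have hψ := integrable_of_essBounded_of_support_subset hmeas hbd hsupp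
  set M := (eLpNorm ψ ⊤ volume).toNNReal
  set V := (volume (Metric.closedBall (0 : EuclideanSpace ℝ (Fin d)) r0)).toNNReal
  have hVcoe : volume (Metric.closedBall (0 : EuclideanSpace ℝ (Fin d)) r0) = V :=
    (ENNReal.coe_toNNReal measure_closedBall_lt_top.ne).symm
  refine ⟨M * r0 ^ (n + 1) * d ^ (n + 1) * V + 1, by positivity, fun ε hε v hv hvs α hα => ?_⟩
  set S := ∑ γ ∈ Finset.Nat.antidiagonalTuple d (n + 1), eLpNorm (Dmulti (γ + α) v) 2 volume
  have hderiv : Dmulti α (regularizationError ψ ε v) = regularizationError ψ ε (Dmulti α v) := by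
    rw [Dmulti_eq_listPderiv, Dmulti_eq_listPderiv, listPderiv_regularizationError hψ hε hv hvs]
  have hw : ContDiff ℝ ∞ (Dmulti α v) := by
    rw [Dmulti_eq_listPderiv]
    exact hv.listPderiv _
  have hle (I : Fin (n + 1) → Fin d) :
      eLpNorm (listPderiv (List.ofFn I) (Dmulti α v)) 2 volume ≤ S := by
    rw [listPderiv_Dmulti hv]
    refine Finset.single_le_sum (f := fun γ => eLpNorm (Dmulti (γ + α) v) 2 volume)
      (fun _ _ => zero_le) (Finset.Nat.mem_antidiagonalTuple.2 ?_)
    rw [sum_count_eq_length, List.length_ofFn]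
  change eLpNorm (Dmulti α (regularizationError ψ ε v)) 2 volume ≤ _
  rw [hderiv]
  refine (eLpNorm_regularizationError_le (Nat.le_of_succ_le_succ hmsk) hr0 hmeas hbd hsupp hunit
    hmom hε hw).trans ?_
  calc _ ≤ ↑(M * (ε * r0).toNNReal ^ (n + 1)) * ∑ I : Fin (n + 1) → Fin d, (V : ℝ≥0∞) * S := by
        rw [hVcoe]
        gcongr with I
        exact hle I
    _ = ENNReal.ofReal (M * r0 ^ (n + 1) * d ^ (n + 1) * V * ε ^ (n + 1)) * S := by
        rw [Finset.sum_const, Finset.card_univ, Fintype.card_fun, Fintype.card_fin,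
          Fintype.card_fin, nsmul_eq_mul, ← mul_assoc, ← mul_assoc]
        congr 1
        rw [ENNReal.ofReal, ← ENNReal.coe_natCast, ← ENNReal.coe_mul, ← ENNReal.coe_mul,
          ENNReal.coe_inj]
        ext
        rw [Real.coe_toNNReal _ (by positivity)]
        push_cast
        rw [Real.coe_toNNReal _ (by positivity)]
        ring
    _ ≤ _ := by
        gcongr
        linarith
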